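/- (Nonexistence of equivariant maps from the join [r]^{*r} to the sphere.) Let r be a prime power. Then there is no continuous S_r-equivariant map from the configuration space C₃ to the sphere S^{r-2}, where S^{r-2} = {y : Fin r → ℝ | ∑ i, y i = 0 ∧ ‖y‖ = 1} with S_r acting by permuting coordinates ((σ·y) i = y (σ⁻¹ i)), and equivariance means f(σ·M) = σ·f(M) for all σ ∈ S_r and M ∈ C₃. -/

import Mathlib

/-- The configuration space `C₃`, the geometric realization of the `r`-fold
join `[r]^{*r}`: matrices with nonnegative entries summing to `1` and
at most one nonzero entry in each column (no restriction on rows). -/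
def ConfC3 (r : ℕ) : Set (Fin r → Fin r → ℝ) :=
  {M | (∀ b t, 0 ≤ M b t) ∧ (∑ b, ∑ t, M b t) = 1 ∧
    (∀ t b b', M b t ≠ 0 → M b' t ≠ 0 → b = b')}

/-- The action of `σ ∈ S_r` on configuration spaces of matrices,
permuting the rows (boxes). -/
def rowPerm {r m : ℕ} (σ : Equiv.Perm (Fin r)) (M : Fin r → Fin m → ℝ) :
    Fin r → Fin m → ℝ :=
  fun b t => M (σ⁻¹ b) t

noncomputable section

/-- Augmented ordered chains: formal integer combinations of lists of vertices. -/
abbrev OrdChain (E : Type*) := List E →₀ ℤ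

namespace OrdChain

variable {E E' : Type*}

/-- The cone operator with apex `x`. -/
def cone (x : E) : OrdChain E →ₗ[ℤ] OrdChain E := Finsupp.lmapDomain ℤ ℤ (List.cons x)

@[simp] lemma cone_single (x : E) (l : List E) (a : ℤ) :
    cone x (Finsupp.single l a) = Finsupp.single (x :: l) a := by
  simp [cone]

/-- The alternating sum of the faces of a simplex. -/
def faces (l : List E) : OrdChain E :=
  ∑ i : Fin l.length, (-1 : ℤ) ^ (i : ℕ) • Finsupp.single (l.eraseIdx i) 1

@[simp] lemma faces_nil : faces ([] : List E) = 0 := by simp [faces]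

lemma faces_cons (x : E) (l : List E) :
    faces (x :: l) = Finsupp.single l 1 - cone x (faces l) := by
  simp only [faces, List.length_cons]
  rw [Fin.sum_univ_succ]
  simp only [map_sum, map_smul, cone_single, sub_eq_add_neg, ← Finset.sum_neg_distrib]
  congr 1
  · simp
  · refine Finset.sum_congr rfl fun i _ => ?_
    simp [pow_succ]

/-- The (augmented) boundary operator. -/
def bdry : OrdChain E →ₗ[ℤ] OrdChain E := Finsupp.linearCombination ℤ faces

@[simp] lemma bdry_single (l : List E) : bdry (Finsupp.single l 1) = faces l := by
  simp [bdry]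

lemma hom_ext {M : Type*} [AddCommGroup M] {f g : OrdChain E →ₗ[ℤ] M}
    (h : ∀ l, f (Finsupp.single l 1) = g (Finsupp.single l 1)) (c : OrdChain E) : f c = g c := by
  have : f = g := by
    ext l
    simpa using h l
  rw [this]

lemma bdry_cone (x : E) (c : OrdChain E) : bdry (cone x c) = c - cone x (bdry c) := by
  refine hom_ext (f := bdry ∘ₗ cone x) (g := LinearMap.id - cone x ∘ₗ bdry) (fun l => ?_) c
  simp [faces_cons]

lemma apply_faces {M : Type*} [AddCommGroup M] (f : OrdChain E →ₗ[ℤ] M) (l : List E) :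
    f (faces l) =
      ∑ i : Fin l.length, (-1 : ℤ) ^ (i : ℕ) • f (Finsupp.single (l.eraseIdx i) 1) := by
  simp only [faces, map_sum, map_smul]

lemma bdry_faces (l : List E) : bdry (faces l) = 0 := by
  induction l with
  | nil => simp
  | cons x l ih => simp [faces_cons, bdry_cone, ih]

/-- The map on chains induced by a map of vertices. -/
def map (g : E → E') : OrdChain E →ₗ[ℤ] OrdChain E' := Finsupp.lmapDomain ℤ ℤ (List.map g)

@[simp] lemma map_single (g : E → E') (l : List E) (a : ℤ) :
    map g (Finsupp.single l a) = Finsupp.single (l.map g) a := by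
  simp [map]

lemma map_cone (g : E → E') (x : E) (c : OrdChain E) :
    map g (cone x c) = cone (g x) (map g c) :=
  hom_ext (f := map g ∘ₗ cone x) (g := cone (g x) ∘ₗ map g) (fun l => by simp) c

lemma map_faces (g : E → E') (l : List E) : map g (faces l) = faces (l.map g) := by
  induction l with
  | nil => simp
  | cons x l ih => simp [faces_cons, map_cone, ih]

lemma map_bdry (g : E → E') (c : OrdChain E) : map g (bdry c) = bdry (map g c) :=
  hom_ext (f := map g ∘ₗ bdry) (g := bdry ∘ₗ map g) (fun l => by simp [map_faces]) c

lemma length_induction {P : List E → Prop} (h0 : P [])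
    (h : ∀ l, l ≠ [] → (∀ i < l.length, P (l.eraseIdx i)) → P l) (l : List E) : P l := by
  induction hn : l.length generalizing l with
  | zero => simpa [List.length_eq_zero_iff.1 hn] using h0
  | succ n ih =>
    refine h l (by rintro rfl; simp at hn) fun i hi => ih _ ?_
    rw [List.length_eraseIdx_of_lt hi]
    omega

section Subdivision

variable [AddCommGroup E] [Module ℝ E] [AddCommGroup E'] [Module ℝ E']

/-- The barycenter of a list of points. -/
def barycenter (l : List E) : E := (l.length : ℝ)⁻¹ • l.sum

lemma map_barycenter (g : E →ₗ[ℝ] E') (l : List E) :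
    g (barycenter l) = barycenter (l.map g) := by
  simp [barycenter, map_list_sum]

/-- The barycentric subdivision of a simplex. -/
def sdList (l : List E) : OrdChain E :=
  if l = [] then Finsupp.single [] 1 else
    cone (barycenter l) (∑ i : Fin l.length, (-1 : ℤ) ^ (i : ℕ) • sdList (l.eraseIdx i))
termination_by l.length
decreasing_by
  have := i.2
  rw [List.length_eraseIdx_of_lt this]
  omega

/-- Barycentric subdivision of chains. -/
def sd : OrdChain E →ₗ[ℤ] OrdChain E := Finsupp.linearCombination ℤ sdList

@[simp] lemma sd_single (l : List E) : sd (Finsupp.single l 1) = sdList l := by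
  simp [sd]

@[simp] lemma sdList_nil : sdList ([] : List E) = Finsupp.single [] 1 := by
  simp [sdList]

lemma sdList_of_ne_nil {l : List E} (h : l ≠ []) :
    sdList l = cone (barycenter l) (sd (faces l)) := by
  rw [sdList, if_neg h, apply_faces]
  simp only [sd_single]

lemma bdry_sdList (l : List E) : bdry (sdList l) = sd (faces l) := by
  induction l using length_induction with
  | h0 => simp
  | h l hl ih =>
    rw [sdList_of_ne_nil hl, bdry_cone]
    have : bdry (sd (faces l)) = sd (bdry (faces l)) := by
      rw [apply_faces sd, apply_faces bdry, map_sum, map_sum]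
      refine Finset.sum_congr rfl fun i _ => ?_
      rw [map_smul, map_smul, sd_single, bdry_single, ih i i.2]
    rw [this, bdry_faces]
    simp

lemma bdry_sd (c : OrdChain E) : bdry (sd c) = sd (bdry c) := by
  rw [← LinearMap.comp_apply, ← LinearMap.comp_apply]
  refine hom_ext (fun l => ?_) c
  rw [LinearMap.comp_apply, LinearMap.comp_apply, sd_single, bdry_single, bdry_sdList]

lemma map_sdList (g : E →ₗ[ℝ] E') (l : List E) : map g (sdList l) = sdList (l.map g) := by
  induction l using length_induction with
  | h0 => simp
  | h l hl ih =>
    rw [sdList_of_ne_nil hl, sdList_of_ne_nil (by simpa using hl), map_cone, map_barycenter,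
      ← map_faces]
    congr 1
    rw [apply_faces sd, apply_faces (map g), map_sum, map_sum]
    refine Finset.sum_congr rfl fun i _ => ?_
    rw [map_smul, map_smul, sd_single, map_single, sd_single, ih i i.2]

lemma map_sd (g : E →ₗ[ℝ] E') (c : OrdChain E) : map g (sd c) = sd (map g c) :=
  hom_ext (f := map g ∘ₗ sd) (g := sd ∘ₗ map g) (fun l => by simp [map_sdList]) c

end Subdivision

/-- Chains all of whose simplices satisfy `Q`. -/
abbrev carried (Q : List E → Prop) : Submodule ℤ (OrdChain E) := Finsupp.supported ℤ ℤ {l | Q l}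

lemma single_mem_carried {Q : List E → Prop} {l : List E} (h : Q l) :
    Finsupp.single l 1 ∈ carried Q :=
  Finsupp.single_mem_supported ℤ _ h

lemma map_mem_of_carried {M : Type*} [AddCommGroup M] {Q : List E → Prop} {S : Submodule ℤ M}
    (f : OrdChain E →ₗ[ℤ] M) (h : ∀ l, Q l → f (Finsupp.single l 1) ∈ S) {c : OrdChain E}
    (hc : c ∈ carried Q) : f c ∈ S := by
  rw [carried, Finsupp.supported_eq_span_single] at hc
  refine Submodule.span_induction (p := fun c _ => f c ∈ S) ?_ ?_ ?_ ?_ hc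
  · rintro _ ⟨l, hl, rfl⟩
    exact h l hl
  · simp
  · intro x y _ _ hx hy
    simpa using S.add_mem hx hy
  · intro a x _ hx
    simpa using S.smul_mem a hx

lemma eq_of_carried {M : Type*} [AddCommGroup M] {Q : List E → Prop}
    {f g : OrdChain E →ₗ[ℤ] M} (h : ∀ l, Q l → f (Finsupp.single l 1) = g (Finsupp.single l 1))
    {c : OrdChain E} (hc : c ∈ carried Q) : f c = g c := by
  have := map_mem_of_carried (S := ⊥) (f - g) (fun l hl => by simp [h l hl]) hc
  simpa [sub_eq_zero] using this

lemma cone_mem_carried {Q Q' : List E → Prop} {x : E} (h : ∀ l, Q l → Q' (x :: l))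
    {c : OrdChain E} (hc : c ∈ carried Q) : cone x c ∈ carried Q' :=
  map_mem_of_carried _ (fun l hl => by
    rw [cone_single]; exact single_mem_carried (h l hl)) hc

section Mesh

variable [NormedAddCommGroup E] [NormedSpace ℝ E]

lemma barycenter_mem {C : Set E} (hC : Convex ℝ C) {l : List E} (hl : l ≠ [])
    (h : ∀ p ∈ l, p ∈ C) : barycenter l ∈ C := by
  have hpos : 0 < l.length := List.length_pos_iff.2 hl
  have : barycenter l = ∑ i : Fin l.length, (l.length : ℝ)⁻¹ • l.get i := by
    rw [← Finset.smul_sum, barycenter]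
    congr 1
    rw [← List.sum_ofFn, List.ofFn_get]
  rw [this]
  refine hC.sum_mem (fun _ _ => by positivity) ?_ fun i _ => h _ (List.get_mem _ _)
  simp
  field_simp

lemma dist_barycenter_le {l : List E} {D : ℝ} (h : ∀ p ∈ l, ∀ q ∈ l, dist p q ≤ D) {p : E}
    (hp : p ∈ l) : dist p (barycenter l) ≤ (1 - (l.length : ℝ)⁻¹) * D := by
  obtain ⟨j, rfl⟩ := List.get_of_mem hp
  have hpos : 0 < l.length := j.pos
  have hb : l.get j - barycenter l =
      (l.length : ℝ)⁻¹ • ∑ i : Fin l.length, (l.get j - l.get i) := by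
    have : ∑ i : Fin l.length, l.get i = l.sum := by rw [← List.sum_ofFn, List.ofFn_get]
    rw [Finset.sum_sub_distrib, this, smul_sub, barycenter]
    congr 1
    simp only [Finset.sum_const, Finset.card_univ, Fintype.card_fin, ← Nat.cast_smul_eq_nsmul ℝ,
      smul_smul]
    rw [inv_mul_cancel₀ (by positivity), one_smul]
  rw [dist_eq_norm, hb, norm_smul, norm_inv, Real.norm_natCast]
  have : ‖∑ i : Fin l.length, (l.get j - l.get i)‖ ≤ (l.length - 1) * D := by
    rw [← Finset.sum_erase_add _ _ (Finset.mem_univ j), sub_self, add_zero]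
    refine (norm_sum_le_of_le _ (f := fun i => l.get j - l.get i) (n := fun _ => D) ?_).trans ?_
    · intro i _
      rw [← dist_eq_norm]
      exact h _ (List.get_mem _ _) _ (List.get_mem _ _)
    · simp [Finset.card_erase_of_mem, Nat.cast_sub (Nat.succ_le_of_lt hpos)]
  calc _ ≤ (l.length : ℝ)⁻¹ * ((l.length - 1) * D) := by gcongr
    _ = _ := by field_simp

lemma sd_faces_mem {Q : List E → Prop} {l : List E}
    (h : ∀ i < l.length, sdList (l.eraseIdx i) ∈ carried Q) : sd (faces l) ∈ carried Q := by
  rw [apply_faces]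
  exact Submodule.sum_mem _ fun i _ => Submodule.smul_mem _ _ (by simpa using h i i.2)

lemma sdList_mem_convex {C : Set E} (hC : Convex ℝ C) (l : List E) (h : ∀ p ∈ l, p ∈ C) :
    sdList l ∈ carried fun l' => l'.length = l.length ∧ ∀ p ∈ l', p ∈ C := by
  induction l using length_induction with
  | h0 => simpa using single_mem_carried (by simp)
  | h l hl ih =>
    rw [sdList_of_ne_nil hl]
    refine cone_mem_carried (Q := fun l' => l'.length = l.length - 1 ∧ ∀ p ∈ l', p ∈ C) ?_ ?_
    · rintro l' ⟨h1, h2⟩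
      have := List.length_pos_iff.2 hl
      refine ⟨by simp; omega, ?_⟩
      simpa using ⟨barycenter_mem hC hl h, h2⟩
    · refine sd_faces_mem fun i hi => ?_
      have := ih i hi fun p hp => h p (List.mem_of_mem_eraseIdx hp)
      rwa [List.length_eraseIdx_of_lt hi] at this

lemma sdList_mem_small (K : ℕ) {D : ℝ} (hD : 0 ≤ D) (l : List E) (hK : l.length ≤ K)
    (h : ∀ p ∈ l, ∀ q ∈ l, dist p q ≤ D) :
    sdList l ∈ carried fun l' => ∀ p ∈ l', ∀ q ∈ l', dist p q ≤ (1 - (K : ℝ)⁻¹) * D := by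
  induction l using length_induction with
  | h0 => simpa using single_mem_carried (by simp)
  | h l hl ih =>
    rw [sdList_of_ne_nil hl]
    have hpos := List.length_pos_iff.2 hl
    have hinv : (K : ℝ)⁻¹ ≤ (l.length : ℝ)⁻¹ := by gcongr
    have hle : (1 - (l.length : ℝ)⁻¹) * D ≤ (1 - (K : ℝ)⁻¹) * D := by gcongr
    have h0 : 0 ≤ (1 - (K : ℝ)⁻¹) * D := by
      have : (K : ℝ)⁻¹ ≤ 1 := inv_le_one_of_one_le₀ (by exact_mod_cast hpos.trans_le hK)
      exact mul_nonneg (by linarith) hD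
    set C := Metric.closedBall (barycenter l) ((1 - (K : ℝ)⁻¹) * D)
    refine cone_mem_carried (Q := fun l' => (∀ p ∈ l', p ∈ C) ∧
      ∀ p ∈ l', ∀ q ∈ l', dist p q ≤ (1 - (K : ℝ)⁻¹) * D) ?_ ?_
    · rintro l' ⟨h1, h2⟩ p hp q hq
      rcases List.mem_cons.1 hp with rfl | hp <;> rcases List.mem_cons.1 hq with rfl | hq
      · simpa using h0
      · rw [dist_comm]; exact h1 q hq
      · exact h1 p hp
      · exact h2 p hp q hq
    · refine sd_faces_mem fun i hi => ?_
      have h1 := sdList_mem_convex (C := C) (convex_closedBall _ _) (l.eraseIdx i)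
        fun p hp => (dist_barycenter_le h (List.mem_of_mem_eraseIdx hp)).trans hle
      have h2 := ih i hi (by rw [List.length_eraseIdx_of_lt hi]; omega)
        fun p hp q hq => h p (List.mem_of_mem_eraseIdx hp) q (List.mem_of_mem_eraseIdx hq)
      rw [carried, Finsupp.mem_supported] at *
      exact fun l' hl' => ⟨(h1 hl').2, h2 hl'⟩

lemma sd_iterate_mem {C : Set E} (hC : Convex ℝ C) {D : ℝ} (hD : 0 ≤ D) (l : List E)
    (h : ∀ p ∈ l, p ∈ C) (hdist : ∀ p ∈ l, ∀ q ∈ l, dist p q ≤ D) {K : ℕ} (hK : l.length ≤ K)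
    (hK0 : 0 < K) (N : ℕ) :
    (sd ^ N) (Finsupp.single l 1) ∈ carried fun l' => l'.length = l.length ∧ (∀ p ∈ l', p ∈ C) ∧
      ∀ p ∈ l', ∀ q ∈ l', dist p q ≤ (1 - (K : ℝ)⁻¹) ^ N * D := by
  induction N with
  | zero => exact single_mem_carried ⟨rfl, h, by simpa using hdist⟩
  | succ N ih =>
    rw [pow_succ' sd, Module.End.mul_apply]
    refine map_mem_of_carried sd (fun l' hl' => ?_) ih
    obtain ⟨h1, h2, h3⟩ := hl'
    have hq : (K : ℝ)⁻¹ ≤ 1 := inv_le_one_of_one_le₀ (by exact_mod_cast hK0)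
    have h4 := sdList_mem_convex hC l' h2
    have h5 := sdList_mem_small K (D := (1 - (K : ℝ)⁻¹) ^ N * D)
      (mul_nonneg (pow_nonneg (by linarith) _) hD) l' (h1 ▸ hK) h3
    rw [sd_single]
    rw [carried, Finsupp.mem_supported] at *
    refine fun l'' hl'' => ⟨(h4 hl'').1.trans h1, (h4 hl'').2, ?_⟩
    have := h5 hl''
    simpa only [Set.mem_ofPred_eq, pow_succ', mul_assoc] using this

end Mesh

section Wedge

variable {ι : Type*} [LinearOrder ι]

/-- The Koszul sign of inserting `i` into (or removing it from) `S`. -/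
def koszulSign (i : ι) (S : Finset ι) : ℤ := (-1) ^ (S.filter (· < i)).card

lemma koszulSign_mul_self (i : ι) (S : Finset ι) : koszulSign i S * koszulSign i S = 1 := by
  rw [koszulSign, ← mul_pow]
  simp

lemma koszulSign_erase_self (i : ι) (S : Finset ι) :
    koszulSign i (S.erase i) = koszulSign i S := by
  rw [koszulSign, koszulSign, Finset.filter_erase, Finset.erase_eq_of_notMem (by simp)]

lemma koszulSign_insert_self (i : ι) (S : Finset ι) :
    koszulSign i (insert i S) = koszulSign i S := by
  rw [koszulSign, koszulSign, Finset.filter_insert, if_neg (lt_irrefl i)]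

lemma koszulSign_insert {i j : ι} {S : Finset ι} (hj : j ∉ S) :
    koszulSign i (insert j S) = (if j < i then -1 else 1) * koszulSign i S := by
  rw [koszulSign, koszulSign, Finset.filter_insert]
  split_ifs
  · rw [Finset.card_insert_of_notMem (by simp [hj]), pow_succ, mul_comm]
  · simp

lemma koszulSign_swap {i j : ι} {S : Finset ι} (hi : i ∈ S) (hj : j ∉ S) :
    koszulSign j S * koszulSign i (insert j S) =
      -(koszulSign i S * koszulSign j (S.erase i)) := by
  have h : koszulSign j S = (if i < j then -1 else 1) * koszulSign j (S.erase i) := by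
    rw [← koszulSign_insert (Finset.notMem_erase i S), Finset.insert_erase hi]
  rw [koszulSign_insert hj, h]
  have hij : i ≠ j := by rintro rfl; exact hj hi
  rcases hij.lt_or_gt with h' | h'
  · simp [h', h'.not_gt]; ring
  · simp [h', h'.not_gt]; ring

/-- Left exterior multiplication by the basis vector `i`, on the exterior algebra
with its basis indexed by finite sets. -/
def create (i : ι) : (Finset ι → ℤ) →ₗ[ℤ] (Finset ι → ℤ) where
  toFun v S := if i ∈ S then koszulSign i S * v (S.erase i) else 0
  map_add' v w := by ext S; by_cases h : i ∈ S <;> simp [h, mul_add]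
  map_smul' a v := by ext S; by_cases h : i ∈ S <;> simp [h]; ring

/-- The iterated exterior product of a list of basis vectors. -/
def wedgeList : List ι → Finset ι → ℤ
  | [] => Pi.single ∅ 1
  | i :: l => create i (wedgeList l)

lemma toFinset_eq_of_wedgeList_ne_zero {l : List ι} {S : Finset ι} (h : wedgeList l S ≠ 0) :
    l.toFinset = S := by
  induction l generalizing S with
  | nil =>
    by_contra h'
    exact h (Pi.single_eq_of_ne (Ne.symm (by simpa using h')) _)
  | cons i l ih =>
    by_cases hi : i ∈ S
    · have : wedgeList l (S.erase i) ≠ 0 := by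
        intro h0
        apply h
        simp [wedgeList, create, h0]
      rw [List.toFinset_cons, ih this, Finset.insert_erase hi]
    · exact absurd (by simp [wedgeList, create, hi]) h

lemma wedgeList_of_sorted {l : List ι} (h : l.Pairwise (· < ·)) :
    wedgeList l = Pi.single l.toFinset 1 := by
  induction l with
  | nil => rfl
  | cons i l ih =>
    rw [List.pairwise_cons] at h
    have hi : i ∉ l.toFinset := by
      intro hi
      exact lt_irrefl i (h.1 i (by simpa using hi))
    ext S
    rw [wedgeList, ih h.2, List.toFinset_cons]
    by_cases hS : S = insert i l.toFinset
    · subst hS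
      have : (insert i l.toFinset).filter (· < i) = ∅ := by
        ext j
        simp only [Finset.mem_filter, Finset.mem_insert, List.mem_toFinset, Finset.notMem_empty,
          iff_false, not_and, not_lt]
        rintro (rfl | hj)
        · rfl
        · exact (h.1 j hj).le
      simp [create, koszulSign, this, Finset.erase_insert hi]
    · rw [Pi.single_eq_of_ne hS]
      by_cases hiS : i ∈ S
      · have : S.erase i ≠ l.toFinset := by
          rintro h'
          exact hS (by rw [← h', Finset.insert_erase hiS])
        simp [create, Pi.single_eq_of_ne this]
      · simp [create, hiS]

lemma wedgeList_map {κ : Type*} [LinearOrder κ] {g : ι → κ} {T : Finset ι}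
    (hg : StrictMonoOn g T) {l : List ι} (hl : ∀ i ∈ l, i ∈ T) {S : Finset ι} (hS : S ⊆ T) :
    wedgeList (l.map g) (S.image g) = wedgeList l S := by
  induction l generalizing S with
  | nil => simp [wedgeList, Pi.single_apply, Finset.image_eq_empty]
  | cons i l ih =>
    have hi : i ∈ T := hl i (by simp)
    have hmem : g i ∈ S.image g ↔ i ∈ S := by
      refine ⟨fun h => ?_, Finset.mem_image_of_mem g⟩
      obtain ⟨j, hj, hij⟩ := Finset.mem_image.1 h
      rwa [← hg.injOn (hS hj) hi hij]
    have hsign : koszulSign (g i) (S.image g) = koszulSign i S := by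
      rw [koszulSign, koszulSign, Finset.filter_image,
        Finset.card_image_of_injOn fun a ha b hb =>
          hg.injOn (hS (Finset.mem_filter.1 ha).1) (hS (Finset.mem_filter.1 hb).1)]
      congr 2
      refine Finset.filter_congr fun j hj => hg.lt_iff_lt (hS hj) hi
    have herase : (S.image g).erase (g i) = (S.erase i).image g := by
      ext b
      simp only [Finset.mem_erase, Finset.mem_image]
      constructor
      · rintro ⟨hb, a, ha, rfl⟩
        exact ⟨a, ⟨fun h => hb (h ▸ rfl), ha⟩, rfl⟩
      · rintro ⟨a, ⟨hai, ha⟩, rfl⟩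
        exact ⟨fun h => hai (hg.injOn (hS ha) hi h), a, ha, rfl⟩
    have := ih (fun j hj => hl j (by simp [hj])) ((Finset.erase_subset i S).trans hS)
    simp only [List.map_cons, wedgeList, create, LinearMap.coe_mk, AddHom.coe_mk, hmem, hsign,
      herase, this]

/-- Exterior multiplication, extended linearly to chains. -/
def wedge : OrdChain ι →ₗ[ℤ] (Finset ι → ℤ) := Finsupp.linearCombination ℤ wedgeList

@[simp] lemma wedge_single (l : List ι) : wedge (Finsupp.single l 1) = wedgeList l := by
  simp [wedge]

lemma wedge_cone (i : ι) (c : OrdChain ι) : wedge (cone i c) = create i (wedge c) := by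
  rw [← LinearMap.comp_apply, ← LinearMap.comp_apply]
  exact hom_ext (fun l => by simp [wedgeList]) c

variable [Fintype ι]

/-- Contraction by the functional taking the value `1` on every basis vector. -/
def contract : (Finset ι → ℤ) →ₗ[ℤ] (Finset ι → ℤ) where
  toFun v S := ∑ j ∈ Sᶜ, koszulSign j S * v (insert j S)
  map_add' v w := by ext S; simp [mul_add, Finset.sum_add_distrib]
  map_smul' a v := by
    ext S
    simp only [Pi.smul_apply, smul_eq_mul, RingHom.id_apply, Finset.mul_sum]
    exact Finset.sum_congr rfl fun _ _ => by ring

lemma contract_create (i : ι) (v : Finset ι → ℤ) :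
    contract (create i v) = v - create i (contract v) := by
  ext S
  simp only [contract, create, LinearMap.coe_mk, AddHom.coe_mk, Pi.sub_apply]
  by_cases hi : i ∈ S
  · rw [if_pos hi, Finset.compl_erase, Finset.sum_insert (by simpa using hi),
      Finset.insert_erase hi, koszulSign_erase_self, mul_add, ← mul_assoc, koszulSign_mul_self,
      one_mul, sub_add_cancel_left, Finset.mul_sum, ← Finset.sum_neg_distrib]
    refine Finset.sum_congr rfl fun j hj => ?_
    have hj : j ∉ S := by simpa using hj
    have hij : i ≠ j := by rintro rfl; exact hj hi
    rw [if_pos (by simp [hi]), ← mul_assoc, koszulSign_swap hi hj,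
      Finset.erase_insert_of_ne hij.symm]
    ring
  · rw [if_neg hi, Finset.sum_eq_single i]
    · rw [if_pos (by simp), koszulSign_insert_self, Finset.erase_insert hi, ← mul_assoc,
        koszulSign_mul_self]
      simp
    · intro j _ hj
      rw [if_neg (by simp [hj.symm, hi])]
      simp
    · intro h
      simp [hi] at h

lemma contract_wedge (c : OrdChain ι) : contract (wedge c) = wedge (bdry c) := by
  rw [← LinearMap.comp_apply, ← LinearMap.comp_apply]
  refine hom_ext (fun l => ?_) c
  simp only [LinearMap.comp_apply, wedge_single, bdry_single]
  induction l with
  | nil =>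
    ext S
    simp [wedgeList, contract]
  | cons i l ih =>
    rw [wedgeList, contract_create, ih, faces_cons, map_sub, wedge_cone, wedge_single]

/-- The grading involution. -/
def gradeInv : (Finset ι → ℤ) →ₗ[ℤ] (Finset ι → ℤ) where
  toFun v S := (-1) ^ S.card * v S
  map_add' v w := by ext S; simp [mul_add]
  map_smul' a v := by ext S; simp; ring

lemma gradeInv_contract (v : Finset ι → ℤ) : gradeInv (contract v) = -contract (gradeInv v) := by
  ext S
  simp only [gradeInv, contract, LinearMap.coe_mk, AddHom.coe_mk, Pi.neg_apply, Finset.mul_sum,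
    ← Finset.sum_neg_distrib]
  refine Finset.sum_congr rfl fun j hj => ?_
  rw [Finset.card_insert_of_notMem (by simpa using hj), pow_succ]
  ring

/-- The Hopf trace formula for an endomorphism of the (acyclic) augmented chain complex of a
simplex: its alternating trace vanishes. -/
lemma alternating_trace_eq_zero [Nonempty ι] (Φ : (Finset ι → ℤ) →ₗ[ℤ] (Finset ι → ℤ))
    (h : ∀ v, contract (Φ v) = Φ (contract v)) :
    ∑ T : Finset ι, (-1) ^ T.card * Φ (Pi.single T 1) T = 0 := by
  obtain ⟨i⟩ := ‹Nonempty ι›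
  have htr : ∀ A : (Finset ι → ℤ) →ₗ[ℤ] (Finset ι → ℤ),
      LinearMap.trace ℤ _ A = ∑ T : Finset ι, A (Pi.single T 1) T := by
    intro A
    rw [LinearMap.trace_eq_matrix_trace ℤ (Pi.basisFun ℤ (Finset ι)), Matrix.trace]
    simp
  have hsum : ∑ T : Finset ι, (-1) ^ T.card * Φ (Pi.single T 1) T =
      LinearMap.trace ℤ _ (gradeInv * Φ) := by
    rw [htr]
    rfl
  have hsplit : gradeInv * Φ =
      contract * (-(gradeInv * Φ * create i)) + gradeInv * Φ * create i * contract := by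
    refine LinearMap.ext fun v => ?_
    simp only [LinearMap.add_apply, Module.End.mul_apply, LinearMap.neg_apply, map_neg]
    rw [← gradeInv_contract, h, contract_create, ← map_add, ← map_add, sub_add_cancel]
  rw [hsum, hsplit, map_add, LinearMap.trace_mul_comm, ← map_add]
  simp

/-- The Hopf trace formula for a chain map defined on the sorted lists of vertices of a simplex. -/
lemma alternating_sum_eq_zero [Nonempty ι] (F : OrdChain ι →ₗ[ℤ] (Finset ι → ℤ))
    (hF : ∀ c, contract (F c) = F (bdry c)) :
    ∑ T : Finset ι, (-1) ^ T.card * F (Finsupp.single T.sort 1) T = 0 := by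
  set Φ : (Finset ι → ℤ) →ₗ[ℤ] (Finset ι → ℤ) :=
    Fintype.linearCombination ℤ fun T : Finset ι => F (Finsupp.single T.sort 1)
  have hΦ : ∀ T : Finset ι, Φ (Pi.single T 1) = F (Finsupp.single T.sort 1) := fun T => by
    simp [Φ, Fintype.linearCombination_apply_single]
  have hsort : ∀ T : Finset ι, T.sort.Pairwise (· < ·) := fun T => T.sortedLT_sort.pairwise
  have hlist : ∀ l : List ι, l.Pairwise (· < ·) →
      (Φ ∘ₗ wedge) (Finsupp.single l 1) = F (Finsupp.single l 1) := by
    intro l hl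
    rw [LinearMap.comp_apply, wedge_single, wedgeList_of_sorted hl, hΦ,
      (List.toFinset_sort (· ≤ ·) (hl.imp ne_of_lt)).2 (hl.imp le_of_lt)]
  have hfaces : ∀ l : List ι, l.Pairwise (· < ·) →
      faces l ∈ carried fun l' : List ι => l'.Pairwise (· < ·) := fun l hl =>
    Submodule.sum_mem _ fun i _ => Submodule.smul_mem _ _
      (single_mem_carried (hl.sublist (List.eraseIdx_sublist _ _)))
  have := alternating_trace_eq_zero Φ fun v => by
    rw [← LinearMap.comp_apply, ← LinearMap.comp_apply]
    congr 1
    refine (Pi.basisFun ℤ (Finset ι)).ext fun T => ?_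
    have hT : (Pi.single T 1 : Finset ι → ℤ) = wedge (Finsupp.single T.sort 1) := by
      rw [wedge_single, wedgeList_of_sorted (hsort T), Finset.sort_toFinset]
    rw [Pi.basisFun_apply, LinearMap.comp_apply, LinearMap.comp_apply, hΦ, hF, hT, contract_wedge,
      bdry_single]
    exact (eq_of_carried hlist (hfaces _ (hsort T))).symm
  simpa only [hΦ] using this

end Wedge

section Labelling

variable {r : ℕ}

/-- The coordinates at which `y` is maximal. -/
def topSet (y : Fin r → ℝ) : Finset (Fin r) := {i | ∀ j, y j ≤ y i}

lemma mem_topSet {y : Fin r → ℝ} {i : Fin r} : i ∈ topSet y ↔ ∀ j, y j ≤ y i := by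
  simp [topSet]

lemma topSet_nonempty [NeZero r] (y : Fin r → ℝ) : (topSet y).Nonempty := by
  obtain ⟨i, hi⟩ := Finite.exists_max y
  exact ⟨i, mem_topSet.2 hi⟩

lemma topSet_comp_perm (y : Fin r → ℝ) (π : Equiv.Perm (Fin r)) :
    topSet (fun i => y (π⁻¹ i)) = (topSet y).image π := by
  ext i
  simp only [mem_topSet, Finset.mem_image]
  constructor
  · intro h
    exact ⟨π⁻¹ i, fun j => by simpa using h (π j), by simp⟩
  · rintro ⟨a, ha, rfl⟩ j
    simpa using ha (π⁻¹ j)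

/-- The maximal coordinates of `F q` lying in the support of `q`. -/
def ownTopSet (F : (Fin r → ℝ) → Fin r → ℝ) (q : Fin r → ℝ) : Finset (Fin r) :=
  {i ∈ topSet (F q) | q i ≠ 0}

/-- A labelling of points by maximal coordinates of `F`, preferring the least one in the
support. -/
def topLabel [NeZero r] (F : (Fin r → ℝ) → Fin r → ℝ) (q : Fin r → ℝ) : Fin r :=
  if h : (ownTopSet F q).Nonempty then (ownTopSet F q).min' h
  else (topSet (F q)).min' (topSet_nonempty _)

lemma topLabel_mem [NeZero r] (F : (Fin r → ℝ) → Fin r → ℝ) (q : Fin r → ℝ) :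
    topLabel F q ∈ topSet (F q) := by
  unfold topLabel
  split_ifs with h
  · exact (Finset.mem_filter.1 ((ownTopSet F q).min'_mem h)).1
  · exact Finset.min'_mem _ _

lemma topLabel_ne_zero [NeZero r] {F : (Fin r → ℝ) → Fin r → ℝ} {q : Fin r → ℝ}
    (h : (ownTopSet F q).Nonempty) : q (topLabel F q) ≠ 0 := by
  unfold topLabel
  rw [dif_pos h]
  exact (Finset.mem_filter.1 ((ownTopSet F q).min'_mem h)).2

/-- Permutation of coordinates as a linear map. -/
def permLin (π : Equiv.Perm (Fin r)) : (Fin r → ℝ) →ₗ[ℝ] (Fin r → ℝ) :=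
  LinearMap.funLeft ℝ ℝ ⇑π⁻¹

lemma permLin_apply (π : Equiv.Perm (Fin r)) (q : Fin r → ℝ) :
    permLin π q = fun i => q (π⁻¹ i) := rfl

/-- The face of the standard simplex spanned by `T`. -/
def simplexFace (T : Finset (Fin r)) : Set (Fin r → ℝ) :=
  stdSimplex ℝ (Fin r) ∩ {q | ∀ i ∉ T, q i = 0}

lemma convex_simplexFace (T : Finset (Fin r)) : Convex ℝ (simplexFace T) := by
  refine (convex_stdSimplex ℝ (Fin r)).inter fun x hx y hy a b _ _ _ i hi => ?_
  simp [hx i hi, hy i hi]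

lemma ownTopSet_permLin {F : (Fin r → ℝ) → Fin r → ℝ} {π : Equiv.Perm (Fin r)} {q : Fin r → ℝ}
    (h : F (permLin π q) = fun i => F q (π⁻¹ i)) :
    ownTopSet F (permLin π q) = (ownTopSet F q).image π := by
  rw [ownTopSet, h, topSet_comp_perm, ownTopSet, Finset.filter_image]
  simp [permLin_apply]

lemma topLabel_permLin [NeZero r] {F : (Fin r → ℝ) → Fin r → ℝ} {π : Equiv.Perm (Fin r)}
    {q : Fin r → ℝ} {T : Finset (Fin r)} (hπ : StrictMonoOn π T) (hq : q ∈ simplexFace T)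
    (h : F (permLin π q) = fun i => F q (π⁻¹ i)) (hown : (ownTopSet F q).Nonempty) :
    topLabel F (permLin π q) = π (topLabel F q) := by
  have hsub : ∀ i ∈ ownTopSet F q, i ∈ T := by
    intro i hi
    by_contra h'
    exact (Finset.mem_filter.1 hi).2 (hq.2 i h')
  have hown' : (ownTopSet F (permLin π q)).Nonempty := by
    rw [ownTopSet_permLin h]
    exact hown.image _
  rw [topLabel, topLabel, dif_pos hown, dif_pos hown']
  refine le_antisymm (Finset.min'_le _ _ ?_) (Finset.le_min' _ _ _ fun i hi => ?_)
  · rw [ownTopSet_permLin h]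
    exact Finset.mem_image_of_mem _ (Finset.min'_mem _ _)
  · rw [ownTopSet_permLin h] at hi
    obtain ⟨a, ha, rfl⟩ := Finset.mem_image.1 hi
    exact hπ.monotoneOn (hsub _ (Finset.min'_mem _ _)) (hsub a ha) (Finset.min'_le _ _ ha)

/-- Simplices for which some coordinate is not maximal at any vertex. -/
def NonCovering (F : (Fin r → ℝ) → Fin r → ℝ) (l : List (Fin r → ℝ)) : Prop :=
  ∃ i, ∀ p ∈ l, i ∉ topSet (F p)

lemma wedgeList_topLabel_eq_zero [NeZero r] {F : (Fin r → ℝ) → Fin r → ℝ}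
    (hF : ∀ q ∈ stdSimplex ℝ (Fin r), ∀ i j, q i = 0 → q j = 0 → F q i = F q j)
    {T : Finset (Fin r)} {l : List (Fin r → ℝ)} (hl : ∀ p ∈ l, p ∈ simplexFace T)
    (hnc : NonCovering F l) {p : Fin r → ℝ} (hp : p ∈ l) (hown : ¬ (ownTopSet F p).Nonempty) :
    wedgeList (l.map (topLabel F)) T = 0 := by
  by_contra h
  obtain ⟨i, hi⟩ := hnc
  have hT := toFinset_eq_of_wedgeList_ne_zero h
  obtain ⟨a, ha⟩ := topSet_nonempty (F p)
  have ha0 : p a = 0 := by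
    by_contra h'
    exact hown ⟨a, Finset.mem_filter.2 ⟨ha, h'⟩⟩
  have hi0 : p i ≠ 0 := by
    intro h'
    refine hi p hp (mem_topSet.2 fun j => ?_)
    rw [hF p (hl p hp).1 i a h' ha0]
    exact mem_topSet.1 ha j
  have hiT : i ∈ T := by
    by_contra h'
    exact hi0 ((hl p hp).2 i h')
  rw [← hT] at hiT
  obtain ⟨p', hp', rfl⟩ := List.mem_map.1 (List.mem_toFinset.1 hiT)
  exact hi p' hp' (topLabel_mem F p')

lemma wedgeList_topLabel_univ [NeZero r] {F : (Fin r → ℝ) → Fin r → ℝ}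
    {l : List (Fin r → ℝ)} (hnc : NonCovering F l) :
    wedgeList (l.map (topLabel F)) Finset.univ = 0 := by
  by_contra h
  obtain ⟨i, hi⟩ := hnc
  have hT := toFinset_eq_of_wedgeList_ne_zero h
  obtain ⟨p', hp', rfl⟩ := List.mem_map.1 (List.mem_toFinset.1 (hT ▸ Finset.mem_univ i))
  exact hi p' hp' (topLabel_mem F p')

lemma permLin_mem_simplexFace {π : Equiv.Perm (Fin r)} {q : Fin r → ℝ} {T : Finset (Fin r)}
    (hq : q ∈ simplexFace T) : permLin π q ∈ simplexFace (T.image π) := by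
  refine ⟨⟨fun i => hq.1.1 _, ?_⟩, fun i hi => hq.2 _ fun h => hi ?_⟩
  · rw [permLin_apply, Equiv.sum_comp π⁻¹ q]
    exact hq.1.2
  · exact Finset.mem_image.2 ⟨_, h, by simp⟩

lemma wedgeList_topLabel_permLin [NeZero r] {F : (Fin r → ℝ) → Fin r → ℝ}
    (hF : ∀ q ∈ stdSimplex ℝ (Fin r), ∀ i j, q i = 0 → q j = 0 → F q i = F q j)
    {π : Equiv.Perm (Fin r)} {T : Finset (Fin r)} (hπ : StrictMonoOn π T)
    (hFπ : ∀ q ∈ simplexFace T, F (permLin π q) = fun i => F q (π⁻¹ i))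
    {l : List (Fin r → ℝ)} (hl : ∀ p ∈ l, p ∈ simplexFace T) (hnc : NonCovering F l) :
    wedgeList ((l.map (permLin π)).map (topLabel F)) (T.image π) =
      wedgeList (l.map (topLabel F)) T := by
  by_cases hown : ∀ p ∈ l, (ownTopSet F p).Nonempty
  · have : (l.map (permLin π)).map (topLabel F) = (l.map (topLabel F)).map π := by
      rw [List.map_map, List.map_map]
      exact List.map_congr_left fun p hp =>
        topLabel_permLin hπ (hl p hp) (hFπ p (hl p hp)) (hown p hp)
    rw [this]
    refine wedgeList_map hπ ?_ subset_rfl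
    simp only [List.mem_map]
    rintro _ ⟨p, hp, rfl⟩
    by_contra h
    exact topLabel_ne_zero (hown p hp) ((hl p hp).2 _ h)
  · push Not at hown
    obtain ⟨p, hp, hown⟩ := hown
    rw [wedgeList_topLabel_eq_zero hF hl hnc hp (by simp [hown])]
    refine wedgeList_topLabel_eq_zero hF (p := permLin π p) ?_ ?_ (List.mem_map_of_mem hp) ?_
    · simp only [List.mem_map]
      rintro _ ⟨p, hp, rfl⟩
      exact permLin_mem_simplexFace (hl p hp)
    · obtain ⟨i, hi⟩ := hnc
      refine ⟨π i, ?_⟩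
      simp only [List.mem_map]
      rintro _ ⟨p, hp, rfl⟩
      rw [hFπ p (hl p hp), topSet_comp_perm]
      simpa using hi p hp
    · rw [ownTopSet_permLin (hFπ p (hl p hp))]
      simp [hown]

lemma exists_nonCovering_of_small {F : (Fin r → ℝ) → Fin r → ℝ}
    (hc : ContinuousOn F (stdSimplex ℝ (Fin r)))
    (hne : ∀ q ∈ stdSimplex ℝ (Fin r), ∃ i j, F q i < F q j) [NeZero r] :
    ∃ ε > 0, ∀ l : List (Fin r → ℝ), (∀ p ∈ l, p ∈ stdSimplex ℝ (Fin r)) →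
      (∀ p ∈ l, ∀ q ∈ l, dist p q < ε) → NonCovering F l := by
  have hopen : ∀ i, ∃ u : Set (Fin r → ℝ), IsOpen u ∧
      F ⁻¹' {y | ∃ j, y i < y j} ∩ stdSimplex ℝ (Fin r) = u ∩ stdSimplex ℝ (Fin r) := by
    intro i
    refine continuousOn_iff'.1 hc _ ?_
    have : {y : Fin r → ℝ | ∃ j, y i < y j} = ⋃ j, {y | y i < y j} := by ext; simp
    rw [this]
    exact isOpen_iUnion fun j => isOpen_lt (continuous_apply i) (continuous_apply j)
  choose u hu hFu using hopen
  obtain ⟨ε, hε, h⟩ := lebesgue_number_lemma_of_metric (isCompact_stdSimplex ℝ (Fin r)) hu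
    (fun q hq => by
      obtain ⟨i, j, hij⟩ := hne q hq
      have : q ∈ u i ∩ stdSimplex ℝ (Fin r) := by
        rw [← hFu]
        exact ⟨⟨j, hij⟩, hq⟩
      exact Set.mem_iUnion.2 ⟨i, this.1⟩)
  refine ⟨ε, hε, fun l hl hd => ?_⟩
  rcases l.eq_nil_or_concat with rfl | ⟨l', p₀, rfl⟩
  · exact ⟨0, by simp⟩
  · obtain ⟨i, hi⟩ := h p₀ (hl p₀ (by simp))
    refine ⟨i, fun p hp hmem => ?_⟩
    have : p ∈ F ⁻¹' {y | ∃ j, y i < y j} ∩ stdSimplex ℝ (Fin r) := by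
      rw [hFu]
      exact ⟨hi (hd p hp p₀ (by simp)), hl p hp⟩
    obtain ⟨⟨j, hj⟩, -⟩ := this
    exact (mem_topSet.1 hmem j).not_gt hj

lemma exists_perm_strictMonoOn {T T' : Finset (Fin r)} (h : T.card = T'.card) :
    ∃ π : Equiv.Perm (Fin r), StrictMonoOn π T ∧ T.image π = T' := by
  let e : T ≃o T' := (T.orderIsoOfFin rfl).symm.trans (T'.orderIsoOfFin h.symm)
  refine ⟨e.toEquiv.extendSubtype, fun a ha b hb hab => ?_, ?_⟩
  · rw [Equiv.extendSubtype_apply_of_mem _ a ha, Equiv.extendSubtype_apply_of_mem _ b hb]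
    exact e.strictMono (a := ⟨a, ha⟩) (b := ⟨b, hb⟩) hab
  · refine Finset.eq_of_subset_of_card_le (fun b hb => ?_) ?_
    · obtain ⟨a, ha, rfl⟩ := Finset.mem_image.1 hb
      exact Equiv.extendSubtype_mem _ a ha
    · rw [Finset.card_image_of_injective _ (Equiv.injective _), h]

lemma sd_pow_nil {E : Type*} [AddCommGroup E] [Module ℝ E] (N : ℕ) :
    (sd ^ N) (Finsupp.single ([] : List E) 1) = Finsupp.single [] 1 := by
  induction N with
  | zero => rfl
  | succ N ih => rw [pow_succ, Module.End.mul_apply, sd_single, sdList_nil, ih]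

lemma bdry_sd_pow {E : Type*} [AddCommGroup E] [Module ℝ E] (N : ℕ) (c : OrdChain E) :
    bdry ((sd ^ N) c) = (sd ^ N) (bdry c) := by
  induction N generalizing c with
  | zero => rfl
  | succ N ih => rw [pow_succ, Module.End.mul_apply, ih, bdry_sd, Module.End.mul_apply]

lemma map_sd_pow {E E' : Type*} [AddCommGroup E] [Module ℝ E] [AddCommGroup E'] [Module ℝ E']
    (g : E →ₗ[ℝ] E') (N : ℕ) (c : OrdChain E) : map g ((sd ^ N) c) = (sd ^ N) (map g c) := by
  induction N generalizing c with
  | zero => rfl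
  | succ N ih => rw [pow_succ, Module.End.mul_apply, ih, map_sd, pow_succ, Module.End.mul_apply]

/-- An integer function on finite sets that depends only on the cardinality, takes the value `1`
on the empty set and `0` on the whole set has nonzero alternating sum if the cardinality of the
whole set is a prime power. -/
lemma alternating_sum_ne_zero (hr : IsPrimePow r) {α : Finset (Fin r) → ℤ}
    (hα : ∀ T T' : Finset (Fin r), T.card = T'.card → α T = α T') (h0 : α ∅ = 1)
    (h1 : α Finset.univ = 0) : ∑ T : Finset (Fin r), (-1) ^ T.card * α T ≠ 0 := by
  intro h
  obtain ⟨p, k, hp, hk, rfl⟩ := hr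
  have hp' : Nat.Prime p := hp.nat_prime
  have hdvd : (p : ℤ) ∣ ∑ T ∈ (Finset.univ : Finset (Finset (Fin (p ^ k)))).erase ∅,
      (-1) ^ T.card * α T := by
    choose! S hS using fun (m : ℕ) (hm : m ≤ p ^ k) =>
      Finset.exists_subset_card_eq (s := (Finset.univ : Finset (Fin (p ^ k)))) (n := m)
        (by simpa using hm)
    have hcard : ∀ T : Finset (Fin (p ^ k)), T.card ≤ p ^ k := fun T => by
      simpa using T.card_le_univ
    set f : ℕ → ℤ := fun m => if m = 0 then 0 else (-1) ^ m * α (S m)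
    have : ∑ T ∈ (Finset.univ : Finset (Finset (Fin (p ^ k)))).erase ∅, (-1) ^ T.card * α T =
        ∑ T ∈ (Finset.univ : Finset (Fin (p ^ k))).powerset, f T.card := by
      rw [Finset.powerset_univ, ← Finset.sum_erase (a := ∅) Finset.univ (by simp [f])]
      refine Finset.sum_congr rfl fun T hT => ?_
      have hT : T.card ≠ 0 := by simpa using hT
      simp only [f, if_neg hT]
      rw [hα T (S T.card) (hS _ (hcard T)).2.symm]
    rw [this, Finset.sum_powerset_apply_card]
    refine Finset.dvd_sum fun m hm => ?_
    rw [nsmul_eq_mul]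
    simp only [Finset.card_univ, Fintype.card_fin, Finset.mem_range, Nat.lt_succ_iff] at hm ⊢
    by_cases hm0 : m = 0
    · simp [f, hm0]
    · by_cases hm1 : m = p ^ k
      · have : α (S m) = 0 := by
          rw [← h1]
          exact hα _ _ (by rw [(hS m hm).2, hm1]; simp)
        simp [f, this]
      · exact Dvd.dvd.mul_right (Int.natCast_dvd_natCast.2 (hp'.dvd_choose_pow hm0 hm1)) _
  rw [← Finset.add_sum_erase _ _ (Finset.mem_univ ∅)] at h
  rw [Finset.card_empty, pow_zero, h0, one_mul] at h
  have h2 : (p : ℤ) ∣ 1 := by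
    rw [eq_neg_of_add_eq_zero_left h]
    exact (dvd_neg).2 hdvd
  exact hp'.one_lt.ne' (by exact_mod_cast Int.eq_one_of_dvd_one (by positivity) h2)

/-- The wedge of the labels on the `N`-th barycentric subdivision of a chain of vertices of the
standard simplex. -/
def labelWedge [NeZero r] (F : (Fin r → ℝ) → Fin r → ℝ) (N : ℕ) :
    OrdChain (Fin r) →ₗ[ℤ] (Finset (Fin r) → ℤ) :=
  wedge ∘ₗ map (topLabel F) ∘ₗ (sd ^ N) ∘ₗ map fun i => (Pi.single i 1 : Fin r → ℝ)

lemma labelWedge_apply [NeZero r] (F : (Fin r → ℝ) → Fin r → ℝ) (N : ℕ) (c : OrdChain (Fin r)) :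
    labelWedge F N c =
      wedge (map (topLabel F) ((sd ^ N) (map (fun i => (Pi.single i 1 : Fin r → ℝ)) c))) := by
  rw [labelWedge, LinearMap.comp_apply, LinearMap.comp_apply, LinearMap.comp_apply]

lemma contract_labelWedge [NeZero r] (F : (Fin r → ℝ) → Fin r → ℝ) (N : ℕ)
    (c : OrdChain (Fin r)) : contract (labelWedge F N c) = labelWedge F N (bdry c) := by
  rw [labelWedge_apply, labelWedge_apply, contract_wedge, ← map_bdry, bdry_sd_pow, map_bdry]

lemma labelWedge_nil [NeZero r] (F : (Fin r → ℝ) → Fin r → ℝ) (N : ℕ) :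
    labelWedge F N (Finsupp.single [] 1) ∅ = 1 := by
  rw [labelWedge_apply, map_single, List.map_nil, sd_pow_nil, map_single, List.map_nil,
    wedge_single]
  simp [wedgeList]

lemma wedge_map_topLabel_univ [NeZero r] {F : (Fin r → ℝ) → Fin r → ℝ}
    {T : Finset (Fin r)} {c : OrdChain (Fin r → ℝ)}
    (hc : c ∈ carried fun l => (∀ p ∈ l, p ∈ simplexFace T) ∧ NonCovering F l) :
    wedge (map (topLabel F) c) Finset.univ = 0 := by
  have := eq_of_carried (f := LinearMap.proj Finset.univ ∘ₗ wedge ∘ₗ map (topLabel F)) (g := 0)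
    (fun l hl => by simpa using wedgeList_topLabel_univ hl.2) hc
  simpa only [LinearMap.comp_apply, LinearMap.proj_apply, LinearMap.zero_apply] using this

lemma wedge_map_topLabel_permLin [NeZero r] {F : (Fin r → ℝ) → Fin r → ℝ}
    (hF : ∀ q ∈ stdSimplex ℝ (Fin r), ∀ i j, q i = 0 → q j = 0 → F q i = F q j)
    {π : Equiv.Perm (Fin r)} {T : Finset (Fin r)} (hπ : StrictMonoOn π T)
    (hFπ : ∀ q ∈ simplexFace T, F (permLin π q) = fun i => F q (π⁻¹ i))
    {c : OrdChain (Fin r → ℝ)}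
    (hc : c ∈ carried fun l => (∀ p ∈ l, p ∈ simplexFace T) ∧ NonCovering F l) :
    wedge (map (topLabel F) (map (permLin π) c)) (T.image π) = wedge (map (topLabel F) c) T := by
  have := eq_of_carried
    (f := LinearMap.proj (T.image π) ∘ₗ wedge ∘ₗ map (topLabel F) ∘ₗ map (permLin π))
    (g := LinearMap.proj T ∘ₗ wedge ∘ₗ map (topLabel F))
    (fun l hl => by
      simp only [LinearMap.comp_apply, LinearMap.proj_apply, map_single, wedge_single]
      exact wedgeList_topLabel_permLin hF hπ hFπ hl.1 hl.2) hc
  simpa only [LinearMap.comp_apply, LinearMap.proj_apply] using this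

lemma sd_pow_face_mem [NeZero r] {F : (Fin r → ℝ) → Fin r → ℝ} {ε : ℝ} {N : ℕ}
    (hnc : ∀ l : List (Fin r → ℝ), (∀ p ∈ l, p ∈ stdSimplex ℝ (Fin r)) →
      (∀ p ∈ l, ∀ q ∈ l, dist p q < ε) → NonCovering F l)
    (hN : (1 - (r : ℝ)⁻¹) ^ N < ε) (T : Finset (Fin r)) :
    (sd ^ N) (Finsupp.single (T.sort.map fun i => (Pi.single i 1 : Fin r → ℝ)) 1) ∈
      carried fun l => (∀ p ∈ l, p ∈ simplexFace T) ∧ NonCovering F l := by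
  have hmem : ∀ p ∈ T.sort.map fun i => (Pi.single i 1 : Fin r → ℝ), p ∈ simplexFace T := by
    simp only [List.mem_map, Finset.mem_sort]
    rintro _ ⟨i, hi, rfl⟩
    refine ⟨single_mem_stdSimplex ℝ i, fun j hj => Pi.single_eq_of_ne ?_ _⟩
    rintro rfl
    exact hj hi
  generalize hL : (T.sort.map fun i => (Pi.single i 1 : Fin r → ℝ)) = L at hmem ⊢
  have hlen : L.length ≤ r := by
    rw [← hL]
    simpa using T.card_le_univ
  have hdist : ∀ p ∈ L, ∀ q ∈ L, dist p q ≤ 1 := by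
    intro p hp q hq
    refine (dist_pi_le_iff zero_le_one).2 fun i => ?_
    have h1 := mem_Icc_of_mem_stdSimplex (hmem p hp).1 i
    have h2 := mem_Icc_of_mem_stdSimplex (hmem q hq).1 i
    simpa using Real.dist_le_of_mem_Icc h1 h2
  have hsd := sd_iterate_mem (convex_simplexFace T) zero_le_one L hmem hdist hlen
    (NeZero.pos r) N
  refine Finsupp.supported_mono (fun l hl => ?_) hsd
  obtain ⟨-, h2, h3⟩ := hl
  refine ⟨h2, hnc l (fun p hp => (h2 p hp).1) fun p hp q hq => (h3 p hp q hq).trans_lt ?_⟩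
  rwa [mul_one]

lemma map_single_image_sort {π : Equiv.Perm (Fin r)} {T : Finset (Fin r)}
    (hπ : StrictMonoOn π T) :
    map (fun i => (Pi.single i 1 : Fin r → ℝ)) (Finsupp.single (T.image π).sort 1) =
      map (permLin π) (Finsupp.single (T.sort.map fun i => (Pi.single i 1 : Fin r → ℝ)) 1) := by
  have hsort : (T.image π).sort = T.sort.map π := by
    have := Finset.map_sort π.toEmbedding T (· ≤ ·) (· ≤ ·)
      fun a ha b hb => (hπ.le_iff_le ha hb).symm
    rw [Finset.map_eq_image] at this
    exact this.symm
  rw [hsort, map_single, map_single, List.map_map, List.map_map]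
  congr 2
  ext i j
  simp [permLin_apply, Pi.single_apply, Equiv.symm_apply_eq]

/-- A map from the standard simplex to `ℝ^r` whose restrictions to the faces of equal dimension
agree up to permutation, and whose coordinates with indices outside the support agree, hits the
diagonal if `r` is a prime power. -/
theorem exists_const_of_isPrimePow (hr : IsPrimePow r) {F : (Fin r → ℝ) → Fin r → ℝ}
    (hc : ContinuousOn F (stdSimplex ℝ (Fin r)))
    (hF : ∀ q ∈ stdSimplex ℝ (Fin r), ∀ i j, q i = 0 → q j = 0 → F q i = F q j)
    (hFπ : ∀ (T : Finset (Fin r)) (π : Equiv.Perm (Fin r)), StrictMonoOn π T →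
      ∀ q ∈ simplexFace T, F (permLin π q) = fun i => F q (π⁻¹ i)) :
    ∃ q ∈ stdSimplex ℝ (Fin r), ∀ i j, F q i = F q j := by
  by_contra! hne
  have hr0 : NeZero r := ⟨hr.ne_zero⟩
  obtain ⟨ε, hε, hnc⟩ := exists_nonCovering_of_small hc fun q hq => by
    obtain ⟨i, j, hij⟩ := hne q hq
    rcases hij.lt_or_gt with h | h
    exacts [⟨i, j, h⟩, ⟨j, i, h⟩]
  have hrpos : (0 : ℝ) < r := by exact_mod_cast hr0.pos
  obtain ⟨N, hN⟩ := exists_pow_lt_of_lt_one hε (y := 1 - (r : ℝ)⁻¹) (by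
    have := inv_pos.2 hrpos
    linarith)
  have hz := alternating_sum_eq_zero _ (contract_labelWedge F N)
  have hcard : ∀ T T' : Finset (Fin r), T.card = T'.card →
      labelWedge F N (Finsupp.single T.sort 1) T =
        labelWedge F N (Finsupp.single T'.sort 1) T' := by
    intro T T' hTT'
    obtain ⟨π, hπ, rfl⟩ := exists_perm_strictMonoOn hTT'
    rw [labelWedge_apply, labelWedge_apply, map_single_image_sort hπ, ← map_sd_pow,
      wedge_map_topLabel_permLin hF hπ (hFπ T π hπ) (sd_pow_face_mem hnc hN T), map_single]
  have hempty : labelWedge F N (Finsupp.single (∅ : Finset (Fin r)).sort 1) ∅ = 1 := by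
    rw [Finset.sort_empty]
    exact labelWedge_nil F N
  have huniv : labelWedge F N (Finsupp.single (Finset.univ : Finset (Fin r)).sort 1)
      Finset.univ = 0 := by
    rw [labelWedge_apply, map_single]
    exact wedge_map_topLabel_univ (sd_pow_face_mem hnc hN Finset.univ)
  generalize labelWedge F N = G at *
  exact alternating_sum_ne_zero hr hcard hempty huniv hz

end Labelling

section CutConfig

variable {r : ℕ}

/-- The `r` interior points dividing the unit interval into equal parts. -/
def samplePoint (t : Fin r) : ℝ := ((t : ℕ) + 1) / ((r : ℝ) + 1)

/-- The left endpoint of the `b`-th interval of the partition of the unit interval with interval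
lengths `q`. -/
def cutStart (q : Fin r → ℝ) (b : Fin r) : ℝ := ∑ i, if i < b then q i else 0

/-- How far the `t`-th sample point is inside the `b`-th interval. -/
def cutDepth (q : Fin r → ℝ) (b t : Fin r) : ℝ :=
  max 0 (min (samplePoint t - cutStart q b) (cutStart q b + q b - samplePoint t))

/-- The configuration that sends each sample point to the interval containing it. -/
def cutConfig (q : Fin r → ℝ) (b t : Fin r) : ℝ :=
  cutDepth q b t / ∑ b', ∑ t', cutDepth q b' t'

lemma samplePoint_pos (t : Fin r) : 0 < samplePoint t := by
  unfold samplePoint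
  positivity

lemma samplePoint_lt_one (t : Fin r) : samplePoint t < 1 := by
  unfold samplePoint
  rw [div_lt_one (by positivity)]
  have : ((t : ℕ) : ℝ) < r := by exact_mod_cast t.2
  linarith

lemma samplePoint_injective : Function.Injective (samplePoint (r := r)) := by
  intro t t' h
  unfold samplePoint at h
  have h0 : (r : ℝ) + 1 ≠ 0 := by positivity
  rw [div_left_inj' h0, add_left_inj] at h
  exact Fin.ext (by exact_mod_cast h)

lemma cutStart_add (q : Fin r → ℝ) (b : Fin r) :
    cutStart q b + q b = ∑ i, if i ≤ b then q i else 0 := by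
  have : q b = ∑ i, if i = b then q i else 0 := by simp
  rw [this, cutStart, ← Finset.sum_add_distrib]
  refine Finset.sum_congr rfl fun i _ => ?_
  rcases lt_trichotomy i b with h | rfl | h
  · simp [h, h.ne, h.le]
  · simp
  · simp [h.not_gt, h.ne', h.not_ge]

lemma cutStart_add_le {q : Fin r → ℝ} (hq : ∀ i, 0 ≤ q i) {b b' : Fin r} (h : b < b') :
    cutStart q b + q b ≤ cutStart q b' := by
  rw [cutStart_add, cutStart]
  refine Finset.sum_le_sum fun i _ => ?_
  by_cases hi : i ≤ b
  · rw [if_pos hi, if_pos (hi.trans_lt h)]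
  · rw [if_neg hi]
    split_ifs
    exacts [hq i, le_rfl]

lemma cutDepth_nonneg (q : Fin r → ℝ) (b t : Fin r) : 0 ≤ cutDepth q b t := le_max_left _ _

lemma cutDepth_eq_zero {q : Fin r → ℝ} {b : Fin r} (h : q b = 0) (t : Fin r) :
    cutDepth q b t = 0 := by
  refine max_eq_left ?_
  rw [h, add_zero]
  rcases le_total (samplePoint t) (cutStart q b) with h | h
  · exact (min_le_left _ _).trans (sub_nonpos.2 h)
  · exact (min_le_right _ _).trans (sub_nonpos.2 h)

lemma cutDepth_pos_iff {q : Fin r → ℝ} {b t : Fin r} :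
    0 < cutDepth q b t ↔ cutStart q b < samplePoint t ∧ samplePoint t < cutStart q b + q b := by
  simp [cutDepth]

lemma exists_cutStart_le {q : Fin r → ℝ} (hq : q ∈ stdSimplex ℝ (Fin r)) (t : Fin r) :
    ∃ b, cutStart q b ≤ samplePoint t ∧ samplePoint t < cutStart q b + q b := by
  have hne : (Finset.univ.filter fun b => samplePoint t < cutStart q b + q b).Nonempty := by
    refine ⟨⟨r - 1, by have := t.2; omega⟩, Finset.mem_filter.2 ⟨Finset.mem_univ _, ?_⟩⟩
    rw [cutStart_add, Finset.sum_congr rfl (g := q)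
      fun i _ => if_pos (Fin.mk_le_mk.2 (by have := i.2; omega)), hq.2]
    exact samplePoint_lt_one t
  obtain ⟨b, hb, hmin⟩ := Finset.exists_min_image _ id hne
  refine ⟨b, ?_, (Finset.mem_filter.1 hb).2⟩
  by_contra! h
  by_cases hb0 : (b : ℕ) = 0
  · have : cutStart q b = 0 :=
      Finset.sum_eq_zero fun i _ => if_neg (by rw [Fin.lt_def]; omega)
    exact (samplePoint_pos t).not_gt (this ▸ h)
  · let b' : Fin r := ⟨b - 1, by have := b.2; omega⟩
    have hb' : cutStart q b' + q b' = cutStart q b := by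
      rw [cutStart_add, cutStart]
      refine Finset.sum_congr rfl fun i _ => if_congr ?_ rfl rfl
      simp only [Fin.le_def, Fin.lt_def, b']
      omega
    have := hmin b' (Finset.mem_filter.2 ⟨Finset.mem_univ _, hb' ▸ h⟩)
    simp only [id, Fin.le_def, b'] at this
    omega

lemma exists_cutDepth_pos [NeZero r] {q : Fin r → ℝ} (hq : q ∈ stdSimplex ℝ (Fin r)) :
    ∃ b t, 0 < cutDepth q b t := by
  by_contra! h
  choose b hb using exists_cutStart_le hq
  have heq : ∀ t, cutStart q (b t) = samplePoint t := fun t =>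
    (hb t).1.eq_or_lt.resolve_right fun h' =>
      (h (b t) t).not_gt (cutDepth_pos_iff.2 ⟨h', (hb t).2⟩)
  have hinj : Function.Injective b := fun t t' htt' =>
    samplePoint_injective (by rw [← heq, ← heq, htt'])
  obtain ⟨t, ht⟩ := Finite.surjective_of_injective hinj 0
  have h0 : cutStart q 0 = 0 := Finset.sum_eq_zero fun i _ => if_neg (Fin.not_lt_zero i)
  have := heq t
  rw [ht, h0] at this
  exact (samplePoint_pos t).ne this

lemma sum_cutDepth_pos [NeZero r] {q : Fin r → ℝ} (hq : q ∈ stdSimplex ℝ (Fin r)) :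
    0 < ∑ b, ∑ t, cutDepth q b t := by
  obtain ⟨b, t, h⟩ := exists_cutDepth_pos hq
  refine Finset.sum_pos' (fun b _ => Finset.sum_nonneg fun t _ => cutDepth_nonneg q b t)
    ⟨b, Finset.mem_univ _, ?_⟩
  exact Finset.sum_pos' (fun t _ => cutDepth_nonneg q b t) ⟨t, Finset.mem_univ _, h⟩

lemma cutConfig_mem [NeZero r] {q : Fin r → ℝ} (hq : q ∈ stdSimplex ℝ (Fin r)) :
    cutConfig q ∈ ConfC3 r := by
  have hpos := sum_cutDepth_pos hq
  refine ⟨fun b t => div_nonneg (cutDepth_nonneg q b t) hpos.le, ?_, fun t b b' hb hb' => ?_⟩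
  · simp only [cutConfig, ← Finset.sum_div]
    exact div_self hpos.ne'
  · have h1 := cutDepth_pos_iff.1
      ((cutDepth_nonneg q b t).lt_of_ne' fun h => hb (by rw [cutConfig, h, zero_div]))
    have h2 := cutDepth_pos_iff.1
      ((cutDepth_nonneg q b' t).lt_of_ne' fun h => hb' (by rw [cutConfig, h, zero_div]))
    rcases lt_trichotomy b b' with h | h | h
    · linarith [cutStart_add_le hq.1 h]
    · exact h
    · linarith [cutStart_add_le hq.1 h]

lemma continuousOn_cutConfig [NeZero r] :
    ContinuousOn (cutConfig (r := r)) (stdSimplex ℝ (Fin r)) := by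
  have hstart : ∀ b : Fin r, Continuous fun q => cutStart q b := fun b =>
    continuous_finsetSum _ fun i _ => by
      split_ifs
      exacts [continuous_apply i, continuous_const]
  have hdepth : ∀ b t : Fin r, Continuous fun q => cutDepth q b t := fun b t => by
    have := hstart b
    unfold cutDepth
    fun_prop
  refine continuousOn_pi.2 fun b => continuousOn_pi.2 fun t => ?_
  refine (hdepth b t).continuousOn.div ?_ fun q hq => (sum_cutDepth_pos hq).ne'
  exact (continuous_finsetSum _ fun b _ => continuous_finsetSum _ fun t _ =>
    hdepth b t).continuousOn

lemma rowPerm_swap_cutConfig {q : Fin r → ℝ} {i j : Fin r} (hi : q i = 0) (hj : q j = 0) :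
    rowPerm (Equiv.swap i j) (cutConfig q) = cutConfig q := by
  ext b t
  simp only [rowPerm, Equiv.swap_inv]
  rcases eq_or_ne b i with rfl | hbi
  · rw [Equiv.swap_apply_left, cutConfig, cutConfig, cutDepth_eq_zero hi, cutDepth_eq_zero hj]
  rcases eq_or_ne b j with rfl | hbj
  · rw [Equiv.swap_apply_right, cutConfig, cutConfig, cutDepth_eq_zero hi, cutDepth_eq_zero hj]
  · rw [Equiv.swap_apply_of_ne_of_ne hbi hbj]

lemma cutDepth_permLin {π : Equiv.Perm (Fin r)} {T : Finset (Fin r)} (hπ : StrictMonoOn π T)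
    {q : Fin r → ℝ} (hq : q ∈ simplexFace T) (b t : Fin r) :
    cutDepth (permLin π q) (π b) t = cutDepth q b t := by
  have hb : permLin π q (π b) = q b := by simp [permLin_apply]
  by_cases hbT : b ∈ T
  · have : cutStart (permLin π q) (π b) = cutStart q b := by
      rw [cutStart, ← Equiv.sum_comp π, cutStart]
      refine Finset.sum_congr rfl fun i _ => ?_
      simp only [permLin_apply, Equiv.Perm.inv_def, Equiv.symm_apply_apply]
      by_cases hi : i ∈ T
      · exact if_congr (hπ.lt_iff_lt hi hbT) rfl rfl
      · rw [hq.2 i hi, ite_self, ite_self]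
    rw [cutDepth, this, hb, cutDepth]
  · rw [cutDepth_eq_zero (hq.2 b hbT), cutDepth_eq_zero (hb.trans (hq.2 b hbT))]

lemma cutConfig_permLin {π : Equiv.Perm (Fin r)} {T : Finset (Fin r)} (hπ : StrictMonoOn π T)
    {q : Fin r → ℝ} (hq : q ∈ simplexFace T) :
    cutConfig (permLin π q) = rowPerm π (cutConfig q) := by
  ext b t
  obtain ⟨a, rfl⟩ := π.surjective b
  rw [rowPerm, Equiv.Perm.inv_def, Equiv.symm_apply_apply, cutConfig, cutConfig,
    cutDepth_permLin hπ hq, ← Equiv.sum_comp π]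
  simp only [cutDepth_permLin hπ hq]

end CutConfig

end OrdChain

end

/-- Nonexistence of equivariant maps from the join `[r]^{*r}` to the sphere
`S^{r-2} = {y : Fin r → ℝ | ∑ i, y i = 0 ∧ ‖y‖ = 1}`, for `r` a prime
power. -/
theorem no_equivariant_map_C3_to_sphere (r : ℕ) (hr : IsPrimePow r) :
    ¬ ∃ f : (Fin r → Fin r → ℝ) → (Fin r → ℝ),
      ContinuousOn f (ConfC3 r) ∧
      (∀ M ∈ ConfC3 r, (∑ i, f M i) = 0 ∧ ‖f M‖ = 1) ∧
      (∀ (σ : Equiv.Perm (Fin r)), ∀ M ∈ ConfC3 r,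
        f (rowPerm σ M) = fun i => f M (σ⁻¹ i)) := by
  rintro ⟨f, hc, hf, hσ⟩
  have hr0 : NeZero r := ⟨hr.ne_zero⟩
  obtain ⟨q, hq, hconst⟩ := OrdChain.exists_const_of_isPrimePow hr
    (F := fun q => f (OrdChain.cutConfig q))
    (hc.comp OrdChain.continuousOn_cutConfig fun q hq => OrdChain.cutConfig_mem hq)
    (fun q hq i j hi hj => by
      have := hσ (Equiv.swap i j) _ (OrdChain.cutConfig_mem hq)
      rw [OrdChain.rowPerm_swap_cutConfig hi hj] at this
      simpa using congrFun this i)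
    (fun T π hπ q hq => by
      rw [OrdChain.cutConfig_permLin hπ hq]
      exact hσ π _ (OrdChain.cutConfig_mem hq.1))
  obtain ⟨hsum, hnorm⟩ := hf _ (OrdChain.cutConfig_mem hq)
  have hzero : f (OrdChain.cutConfig q) = 0 := by
    ext i
    rw [Finset.sum_congr rfl fun j _ => hconst j i] at hsum
    simpa [hr.ne_zero] using hsum
  rw [hzero, norm_zero] at hnorm
  exact zero_ne_one hnorm
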